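/- For each n ≥ 1 let 𝓜_n denote the set of pairs (F, M) where F is an acyclic simple graph (forest) on the vertex set Fin n and M is a maximal matching of F, let m_n = |𝓜_n|, and let Ē_n = (Σ_{(F,M) ∈ 𝓜_n} |M|) / m_n. Then the sequence Ē_n / n converges as n → ∞ to a limit λ satisfying 0.35704 < λ < 0.35705. -/

import Mathlib

open Filter Topology MeasureTheory

/-- `M` is a matching of `G`: a set of edges of `G`, no two distinct
edges of which share a vertex. -/
def IsMatching {V : Type*} (G : SimpleGraph V) (M : Set (Sym2 V)) : Prop :=
  M ⊆ G.edgeSet ∧ ∀ e ∈ M, ∀ f ∈ M, e ≠ f → ∀ v : V, v ∈ e → v ∉ f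

/-- `M` is a maximal matching of `G`. -/
def IsMaximalMatching {V : Type*} (G : SimpleGraph V) (M : Set (Sym2 V)) : Prop :=
  IsMatching G M ∧ ∀ M' : Set (Sym2 V), IsMatching G M' → ¬ M ⊂ M'

/-- The pairs `(F, M)` where `F` is a forest (acyclic simple graph) on `Fin n`
and `M` is a maximal matching of `F`. -/
def MMSpace (n : ℕ) :=
  {p : SimpleGraph (Fin n) × Set (Sym2 (Fin n)) // p.1.IsAcyclic ∧ IsMaximalMatching p.1 p.2}

/-- `mN n` is the number of pairs `(F, M)` where `F` is a forest on `Fin n`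
and `M` is a maximal matching of `F`. -/
noncomputable def mN (n : ℕ) : ℕ := Nat.card (MMSpace n)

/-- The expected number of edges of a uniformly random maximal matching–forest
pair on `n` vertices: the arithmetic mean of `|M|` over all pairs `(F, M)`. -/
noncomputable def Ebar (n : ℕ) : ℝ :=
  (∑ᶠ p : MMSpace n, (p.val.2.ncard : ℝ)) / (mN n : ℝ)

section RootedForests

variable {V : Type*}

/-- The graph joining every vertex to its parent under `P`. -/
def parentGraph (P : V → Option V) : SimpleGraph V :=
  SimpleGraph.fromRel fun x y => P x = some y

/-- A parent function is ranked by `r` if parents have smaller rank. -/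
def RankedBy (P : V → Option V) (r : V → ℕ) : Prop :=
  ∀ x y, P x = some y → r y < r x

lemma RankedBy.adj_iff {P : V → Option V} {r : V → ℕ} (h : RankedBy P r) (x y : V) :
    (parentGraph P).Adj x y ↔ P x = some y ∨ P y = some x := by
  rw [parentGraph, SimpleGraph.fromRel_adj, and_iff_right_iff_imp]
  rintro (hxy | hxy) rfl <;> exact absurd (h _ _ hxy) (lt_irrefl _)

lemma RankedBy.isAcyclic [Finite V] {P : V → Option V} {r : V → ℕ} (h : RankedBy P r) :
    (parentGraph P).IsAcyclic := by
  classical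
  intro v c hc
  obtain ⟨w, hw, hmax⟩ := c.support.toFinset.exists_max_image r ⟨v, by simp⟩
  rw [List.mem_toFinset] at hw
  set d := c.rotate w hw with hd
  have hdc : d.IsCycle := hc.rotate hw
  have key : ∀ x ∈ d.support, (parentGraph P).Adj w x → P w = some x := by
    intro x hx hadj
    have hx' : x ∈ c.support := by
      rw [hd, SimpleGraph.Walk.mem_support_rotate_iff] at hx
      exact hx
    rcases (h.adj_iff _ _).1 hadj with h1 | h1
    · exact h1
    · exact absurd (h _ _ h1) (not_lt.2 (hmax x (by simpa using hx')))
  have h1 := key _ (d.getVert_mem_support _) (d.adj_snd hdc.not_nil)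
  have h2 := key _ (d.getVert_mem_support _) (d.adj_penultimate hdc.not_nil).symm
  exact hdc.snd_ne_penultimate (Option.some.inj (h1.symm.trans h2))

lemma exists_parent_function {G : SimpleGraph V} (hG : G.IsAcyclic) :
    ∃ P : V → Option V, ∀ x y, G.Adj x y ↔ P x = some y ∨ P y = some x := by
  classical
  obtain ⟨root, hroot⟩ : ∃ root : G.ConnectedComponent → V,
      ∀ c, G.connectedComponentMk (root c) = c :=
    ⟨_, Function.surjInv_eq (f := G.connectedComponentMk) Quot.mk_surjective⟩
  have hpath : ∀ v : V, ∃ p : G.Walk v (root (G.connectedComponentMk v)), p.IsPath := by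
    intro v
    obtain ⟨p⟩ := SimpleGraph.ConnectedComponent.exact (hroot (G.connectedComponentMk v)).symm
    exact ⟨p.bypass, p.bypass_isPath⟩
  choose p hp using hpath
  refine ⟨fun v => if (p v).snd = v then none else some (p v).snd, ?_⟩
  have hadj : ∀ x y, (if (p x).snd = x then none else some (p x).snd) = some y → G.Adj x y := by
    intro x y hxy
    split_ifs at hxy with h
    rw [Option.some.injEq] at hxy
    subst hxy
    refine (p x).adj_snd fun hnil => h ?_
    rw [SimpleGraph.Walk.snd, SimpleGraph.Walk.getVert_of_length_le, ← hnil.eq]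
    simp [SimpleGraph.Walk.length_eq_zero_iff.2 hnil]
  intro x y
  constructor
  · intro hxy
    have hc : G.connectedComponentMk x = G.connectedComponentMk y :=
      SimpleGraph.ConnectedComponent.connectedComponentMk_eq_of_adj hxy
    have tail_parent : ∀ {a b c : V} (pa : G.Walk a c) (pb : G.Walk b c), pa.IsPath → pb.IsPath →
        G.Adj a b → b = pa.snd ∨ a = pb.snd := by
      intro a b c pa pb ha hb hab
      by_cases hs : b ∈ pa.support
      · exact Or.inl (hG.eq_snd_of_adj_start ha hab hs)
      · refine Or.inr (hG.eq_snd_of_adj_start hb hab.symm ?_)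
        have := hG.mem_support_of_ne_mem_support_of_adj_of_isPath (p := pb.reverse)
          (q := pa.reverse) hb.reverse ha.reverse hab.symm (by simpa using hs)
        simpa using this
    have := tail_parent (p x) ((p y).copy rfl (by rw [hc])) (hp x) (by simpa using hp y) hxy
    rcases this with h | h
    · left
      change (if (p x).snd = x then none else some (p x).snd) = some y
      rw [if_neg (by rw [← h]; exact hxy.ne'), ← h]
    · right
      have h' : x = (p y).snd := by
        rw [h]; simp [SimpleGraph.Walk.snd]
      change (if (p y).snd = y then none else some (p y).snd) = some x
      rw [if_neg (by rw [← h']; exact hxy.ne), ← h']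
  · rintro (h | h)
    · exact hadj _ _ h
    · exact (hadj _ _ h).symm

/-- A ranked parent function with a single root is determined by its graph and root. -/
lemma RankedBy.eq_of_parentGraph_eq {P P' : V → Option V} {r r' : V → ℕ} (h : RankedBy P r)
    (h' : RankedBy P' r') {v₀ : V} (hroot : ∀ x, P x = none ↔ x = v₀)
    (hroot' : ∀ x, P' x = none ↔ x = v₀) (hG : parentGraph P = parentGraph P') : P = P' := by
  have key : ∀ m x, r x = m → P x = P' x := by
    intro m
    induction m using Nat.strong_induction_on with
    | _ m ih =>
      intro x hx
      cases hPx : P x with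
      | none => exact ((hroot' x).2 ((hroot x).1 hPx)).symm
      | some y =>
        have hadj : (parentGraph P').Adj x y := hG ▸ (h.adj_iff x y).2 (Or.inl hPx)
        rcases (h'.adj_iff x y).1 hadj with h1 | h1
        · exact h1.symm
        · have hlt := h _ _ hPx
          rw [← ih (r y) (hx ▸ hlt) y rfl] at h1
          exact absurd (h _ _ h1) (not_lt.2 hlt.le)
  exact funext fun x => key _ x rfl

end RootedForests

section Slots

variable {V : Type*} {k u : ℕ}

/-- The vertices of a forest with a matching of size `k` and `u` unmatched vertices: the two ends
of every matching edge (the child end first), then the unmatched vertices. -/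
abbrev Slot (k u : ℕ) := (Fin k ⊕ Fin k) ⊕ Fin u

/-- The child end of a matching edge. -/
abbrev Slot.bot (i : Fin k) : Slot k u := Sum.inl (Sum.inl i)

/-- The parent end of a matching edge. -/
abbrev Slot.top (i : Fin k) : Slot k u := Sum.inl (Sum.inr i)

/-- An unmatched vertex. -/
abbrev Slot.free (i : Fin u) : Slot k u := Sum.inr i

/-- Transport of a parent function along a labelling of the slots. -/
def transport (e : Slot k u ≃ V) (q : Slot k u → Option (Slot k u)) (v : V) : Option V :=
  (q (e.symm v)).map e

lemma transport_apply (e : Slot k u ≃ V) (q : Slot k u → Option (Slot k u)) (x : Slot k u) :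
    transport e q (e x) = (q x).map e := by
  simp [transport]

lemma transport_apply_eq_some (e : Slot k u ≃ V) (q : Slot k u → Option (Slot k u))
    (x y : Slot k u) : transport e q (e x) = some (e y) ↔ q x = some y := by
  simp [transport]

lemma transport_injective (e : Slot k u ≃ V) : Function.Injective (transport e) := by
  intro q q' h
  funext x
  have := congrFun h (e x)
  rw [transport_apply, transport_apply] at this
  exact Option.map_injective e.injective this

/-- The matching edges under a labelling of the slots. -/
def pairEdges (e : Slot k u ≃ V) : Set (Sym2 V) :=
  Set.range fun i => s(e (Slot.bot i), e (Slot.top i))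

/-- The relabelling of the slots which permutes the matching edges and the unmatched vertices. -/
def slotPerm (π : Equiv.Perm (Fin k) × Equiv.Perm (Fin u)) : Equiv.Perm (Slot k u) :=
  (π.1.sumCongr π.1).sumCongr π.2

lemma slotPerm_injective : Function.Injective (slotPerm (k := k) (u := u)) := by
  intro π π' h
  refine Prod.ext (Equiv.ext fun i => ?_) (Equiv.ext fun i => ?_)
  · simpa [slotPerm] using DFunLike.congr_fun h (Slot.bot i)
  · simpa [slotPerm] using DFunLike.congr_fun h (Slot.free i)

lemma pairEdges_slotPerm (e : Slot k u ≃ V) (π : Equiv.Perm (Fin k) × Equiv.Perm (Fin u)) :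
    pairEdges ((slotPerm π).trans e) = pairEdges e := by
  have : (fun i => s(((slotPerm π).trans e) (Slot.bot i), ((slotPerm π).trans e) (Slot.top i))) =
      (fun i => s(e (Slot.bot i), e (Slot.top i))) ∘ π.1 := by
    funext i
    simp [slotPerm]
  rw [pairEdges, this, π.1.surjective.range_comp]
  rfl

/-- Conjugation of a parent function by a permutation of the slots. -/
def conjSlot (θ : Equiv.Perm (Slot k u)) (q : Slot k u → Option (Slot k u)) :
    Slot k u → Option (Slot k u) :=
  fun x => (q (θ x)).map θ.symm

lemma transport_conjSlot (e : Slot k u ≃ V) (θ : Equiv.Perm (Slot k u))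
    (q : Slot k u → Option (Slot k u)) :
    transport (θ.trans e) (conjSlot θ q) = transport e q := by
  funext v
  simp only [transport, conjSlot, Equiv.symm_trans_apply, Equiv.apply_symm_apply, Option.map_map]
  congr 1
  funext x
  simp

/-- The admissible parents of a slot: the child end of a matching edge has the other end as its
parent, and an unmatched vertex has no unmatched parent. -/
def parentOptions (k u : ℕ) : Slot k u → Finset (Option (Slot k u))
  | .inl (.inl i) => {some (Slot.top i)}
  | .inl (.inr _) => Finset.univ
  | .inr _ => Finset.insertNone (Finset.univ.disjSum ∅)

lemma mem_parentOptions_free {o : Option (Slot k u)} {i : Fin u} :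
    o ∈ parentOptions k u (Slot.free i) ↔ ∀ j, o ≠ some (Slot.free j) := by
  rcases o with _ | ((x | x) | x) <;> simp [parentOptions]

lemma conjSlot_mem {q : Slot k u → Option (Slot k u)}
    (hq : q ∈ Fintype.piFinset (parentOptions k u))
    (π : Equiv.Perm (Fin k) × Equiv.Perm (Fin u)) :
    conjSlot (slotPerm π) q ∈ Fintype.piFinset (parentOptions k u) := by
  rw [Fintype.mem_piFinset] at hq ⊢
  rintro ((i | i) | i)
  · have := hq (Slot.bot (π.1 i))
    simp only [parentOptions, Finset.mem_singleton] at this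
    simp [parentOptions, conjSlot, slotPerm, this]
  · simp [parentOptions]
  · rw [mem_parentOptions_free]
    intro j hj
    have := mem_parentOptions_free.1 (hq (Slot.free (π.2 i)))
    simp only [conjSlot, slotPerm, Equiv.sumCongr_apply, Sum.map_inr, Option.map_eq_some_iff] at hj
    obtain ⟨a, ha, haj⟩ := hj
    rw [Equiv.symm_apply_eq] at haj
    exact this _ (ha.trans (congrArg some haj))

lemma card_piFinset_parentOptions :
    (Fintype.piFinset (parentOptions k u)).card = (2 * k + u + 1) ^ k * (2 * k + 1) ^ u := by
  rw [Fintype.card_piFinset, Fintype.prod_sum_type, Fintype.prod_sum_type]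
  simp [parentOptions, Finset.card_insertNone, two_mul]

end Slots

section UpperBound

open scoped Nat

variable {n k u : ℕ}

/-- The number of pairs of a forest on `Fin n` and a maximal matching of it with `k` edges. -/
noncomputable def matchingCount (n k : ℕ) : ℕ := Nat.card {p : MMSpace n // p.val.2.ncard = k}

instance (n : ℕ) : Finite (MMSpace n) := by
  unfold MMSpace
  infer_instance

lemma IsMaximalMatching.exists_mem_of_adj {V : Type*} {G : SimpleGraph V} {M : Set (Sym2 V)}
    (hM : IsMaximalMatching G M) {x y : V} (h : G.Adj x y) : ∃ e ∈ M, x ∈ e ∨ y ∈ e := by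
  by_contra! hcon
  have hnot : s(x, y) ∉ M := fun hmem => (hcon _ hmem).1 (Sym2.mem_mk_left x y)
  refine hM.2 (insert s(x, y) M) ⟨?_, ?_⟩ (Set.ssubset_insert hnot)
  · exact Set.insert_subset h hM.1.1
  · rintro e (rfl | he) f (rfl | hf) hne v hve hvf
    · exact hne rfl
    · rcases Sym2.mem_iff.1 hve with rfl | rfl
      · exact (hcon _ hf).1 hvf
      · exact (hcon _ hf).2 hvf
    · rcases Sym2.mem_iff.1 hvf with rfl | rfl
      · exact (hcon _ he).1 hve
      · exact (hcon _ he).2 hve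
    · exact hM.1.2 e he f hf hne v hve hvf

/-- A matching whose edges are oriented by a parent function gives an injective labelling of
its vertices. -/
lemma exists_ends {V : Type*} [Finite V] {G : SimpleGraph V} {M : Set (Sym2 V)}
    (hM : IsMatching G M) {P : V → Option V}
    (hP : ∀ x y, G.Adj x y ↔ P x = some y ∨ P y = some x) (hk : M.ncard = k) :
    ∃ f : Fin k ⊕ Fin k → V, Function.Injective f ∧
      (∀ i, P (f (.inl i)) = some (f (.inr i))) ∧
      M = Set.range fun i => s(f (.inl i), f (.inr i)) := by
  classical
  have hfin : Finite M := inferInstance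
  have hcard : Nat.card M = k := hk
  let ε : Fin k ≃ M := (Finite.equivFinOfCardEq hcard).symm
  have hor : ∀ m : M, ∃ x y, P x = some y ∧ m.1 = s(x, y) := by
    rintro ⟨m, hm⟩
    induction m using Sym2.ind with
    | _ x y =>
      rcases (hP x y).1 (hM.1 hm) with h | h
      · exact ⟨x, y, h, rfl⟩
      · exact ⟨y, x, h, Sym2.eq_swap⟩
  choose b t hbt hm using hor
  have hadj : ∀ m, b m ≠ t m := fun m => ((hP _ _).2 (Or.inl (hbt m))).ne
  have hb : ∀ m, b m ∈ m.1 := fun m => by rw [hm m]; exact Sym2.mem_mk_left _ _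
  have ht : ∀ m, t m ∈ m.1 := fun m => by rw [hm m]; exact Sym2.mem_mk_right _ _
  have huniq : ∀ (m m' : M) (v : V), v ∈ m.1 → v ∈ m'.1 → m = m' := by
    intro m m' v hv hv'
    by_contra hne
    exact hM.2 _ m.2 _ m'.2 (fun h => hne (Subtype.ext h)) v hv hv'
  refine ⟨Sum.elim (b ∘ ε) (t ∘ ε), ?_, fun i => hbt _, ?_⟩
  · rintro (i | i) (j | j) hij <;> simp only [Sum.elim_inl, Sum.elim_inr, Function.comp] at hij
    · rw [ε.injective (huniq _ _ _ (hb (ε i)) (hij ▸ hb (ε j)))]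
    · have := huniq _ _ _ (hb (ε i)) (hij ▸ ht (ε j))
      exact absurd (this ▸ hij) (hadj _)
    · have := huniq _ _ _ (ht (ε i)) (hij ▸ hb (ε j))
      exact absurd (this ▸ hij).symm (hadj _)
    · rw [ε.injective (huniq _ _ _ (ht (ε i)) (hij ▸ ht (ε j)))]
  · ext m
    constructor
    · intro h
      refine ⟨ε.symm ⟨m, h⟩, ?_⟩
      simpa using (hm ⟨m, h⟩).symm
    · rintro ⟨i, rfl⟩
      have := (ε i).2
      rw [hm] at this
      exact this

lemma two_mul_ncard_le (p : MMSpace n) : 2 * p.val.2.ncard ≤ n := by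
  obtain ⟨P, hP⟩ := exists_parent_function p.2.1
  obtain ⟨f, hf, -⟩ := exists_ends p.2.2.1 hP rfl
  have := Fintype.card_le_of_injective f hf
  simpa [two_mul] using this

lemma exists_slot_structure (p : MMSpace n) (hk : p.val.2.ncard = k) (hn : 2 * k + u = n) :
    ∃ (e : Slot k u ≃ Fin n) (q : Slot k u → Option (Slot k u)),
      q ∈ Fintype.piFinset (parentOptions k u) ∧ p.val.2 = pairEdges e ∧
      ∀ x y, p.val.1.Adj x y ↔ transport e q x = some y ∨ transport e q y = some x := by
  classical
  obtain ⟨P, hP⟩ := exists_parent_function p.2.1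
  obtain ⟨f, hf, hfP, hfM⟩ := exists_ends p.2.2.1 hP hk
  have hcompl : Fintype.card ((Set.range f)ᶜ : Set (Fin n)) = u := by
    rw [Fintype.card_compl_set, Set.card_range_of_injective hf]
    simp
    omega
  let e : Slot k u ≃ Fin n :=
    ((Equiv.ofInjective f hf).sumCongr (Fintype.equivFinOfCardEq hcompl).symm).trans
      (Equiv.Set.sumCompl (Set.range f))
  have he : ∀ x, e (Sum.inl x) = f x := fun x => rfl
  have hefree : ∀ i, e (Slot.free i) ∉ Set.range f := fun i =>
    ((Fintype.equivFinOfCardEq hcompl).symm i).2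
  have htr : transport e (fun x => (P (e x)).map e.symm) = P := by
    funext v
    simp only [transport, Equiv.apply_symm_apply, Option.map_map]
    simp
  refine ⟨e, fun x => (P (e x)).map e.symm, ?_, hfM, ?_⟩
  · rw [Fintype.mem_piFinset]
    rintro ((i | i) | i)
    · simp only [parentOptions, Finset.mem_singleton, he, hfP, Option.map_some]
      rw [← he, Equiv.symm_apply_apply]
    · simp [parentOptions]
    · rw [mem_parentOptions_free]
      intro j hj
      rw [Option.map_eq_some_iff] at hj
      obtain ⟨y, hy, hyj⟩ := hj
      rw [Equiv.symm_apply_eq] at hyj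
      subst hyj
      obtain ⟨m, hm, hmem⟩ := p.2.2.exists_mem_of_adj ((hP _ _).2 (Or.inl hy))
      rw [hfM] at hm
      obtain ⟨l, rfl⟩ := hm
      simp only [Sym2.mem_iff] at hmem
      rcases hmem with (h | h) | (h | h)
      · exact hefree i ⟨_, h.symm⟩
      · exact hefree i ⟨_, h.symm⟩
      · exact hefree j ⟨_, h.symm⟩
      · exact hefree j ⟨_, h.symm⟩
  · rw [htr]
    exact hP

theorem matchingCount_mul_le (hn : 2 * k + u = n) :
    matchingCount n k * (k ! * u !) ≤ n ! * ((n + 1) ^ k * (2 * k + 1) ^ u) := by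
  classical
  choose e q hq hM hadj using
    fun p : {p : MMSpace n // p.val.2.ncard = k} => exists_slot_structure p.1 p.2 hn
  let Φ : {p : MMSpace n // p.val.2.ncard = k} × (Equiv.Perm (Fin k) × Equiv.Perm (Fin u)) →
      (Slot k u ≃ Fin n) × Fintype.piFinset (parentOptions k u) :=
    fun x => ((slotPerm x.2).trans (e x.1),
      ⟨conjSlot (slotPerm x.2) (q x.1), conjSlot_mem (hq x.1) _⟩)
  have hΦ : Function.Injective Φ := by
    rintro ⟨p, π⟩ ⟨p', π'⟩ h
    simp only [Φ, Prod.mk.injEq, Subtype.mk.injEq] at h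
    obtain ⟨h1, h2⟩ := h
    have hMM : p.1.val.2 = p'.1.val.2 := by
      rw [hM p, hM p', ← pairEdges_slotPerm (e p) π, ← pairEdges_slotPerm (e p') π', h1]
    have htr : transport (e p) (q p) = transport (e p') (q p') := by
      rw [← transport_conjSlot (e p) (slotPerm π),
        ← transport_conjSlot (e p') (slotPerm π'), h1, h2]
    have hG : p.1.val.1 = p'.1.val.1 := by
      ext x y
      rw [hadj p, hadj p', htr]
    obtain rfl : p = p' := Subtype.ext (Subtype.ext (Prod.ext hG hMM))
    have hπ : slotPerm π = slotPerm π' := by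
      ext x
      exact (e p).injective (DFunLike.congr_fun h1 x)
    rw [slotPerm_injective hπ]
  have := Nat.card_le_card_of_injective Φ hΦ
  have hslot : Fintype.card (Slot k u) = n := by simp; omega
  have hequiv : Nat.card (Slot k u ≃ Fin n) = n ! := by
    rw [Nat.card_eq_fintype_card, Fintype.card_equiv (Fintype.equivFinOfCardEq hslot), hslot]
  rw [Nat.card_prod, Nat.card_prod, Nat.card_prod, hequiv, Nat.card_perm, Nat.card_perm,
    Nat.card_eq_fintype_card (α := Fintype.piFinset _), Fintype.card_coe,
    card_piFinset_parentOptions, hn, Nat.card_fin, Nat.card_fin] at this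
  exact this

end UpperBound

section ForestMatrix

variable {X : Type*} [DecidableEq X]

/-- The row of the Laplacian matrix of a parent function at `x` when the parent of `x` is `o`. -/
def parentRow (x : X) (o : Option X) : X → ℝ :=
  Pi.single x 1 - o.elim 0 fun y => Pi.single y 1

lemma parentRow_apply (x : X) (o : Option X) (y : X) :
    parentRow x o y = (if y = x then 1 else 0) - (if o = some y then 1 else 0) := by
  rcases o with _ | z
  · simp [parentRow, Pi.single_apply]
  · simp [parentRow, Pi.single_apply, eq_comm]

variable [Fintype X]

/-- The Laplacian matrix of a parent function. -/
def parentMatrix (q : X → Option X) : Matrix X X ℝ := Matrix.of fun x => parentRow x (q x)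

lemma RankedBy.det_parentMatrix {q : X → Option X} {r : X → ℕ} (h : RankedBy q r) :
    (parentMatrix q).det = 1 := by
  have hb : (parentMatrix q).BlockTriangular fun x => OrderDual.toDual (r x) := by
    intro x y hxy
    have hlt : r x < r y := hxy
    have h1 : y ≠ x := by rintro rfl; exact lt_irrefl _ hlt
    have h2 : q x ≠ some y := fun hq => absurd (h _ _ hq) (not_lt.2 hlt.le)
    simp [parentMatrix, parentRow_apply, h1, h2]
  rw [hb.det]
  refine Finset.prod_eq_one fun a _ => ?_
  have : (parentMatrix q).toSquareBlock (fun x => OrderDual.toDual (r x)) a = 1 := by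
    ext ⟨x, hx⟩ ⟨y, hy⟩
    have h2 : q x ≠ some y := fun hq => by
      have := h _ _ hq
      have h3 : r y = r x := OrderDual.toDual.injective (hy.trans hx.symm)
      omega
    simp [Matrix.toSquareBlock_def, parentMatrix, parentRow_apply, h2, Matrix.one_apply, eq_comm]
  rw [this, Matrix.det_one]

lemma det_parentMatrix_eq_zero {q : X → Option X} (h : ¬ ∃ r, RankedBy q r) :
    (parentMatrix q).det = 0 := by
  classical
  let g : Option X → Option X := fun o => o.bind q
  have hg : ∀ m x, g^[m + 1] (some x) = g^[m] (q x) := fun m x => by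
    rw [Function.iterate_succ_apply]; rfl
  have hnone : ∀ m, g^[m] none = none := fun m => Function.iterate_fixed rfl m
  by_cases hall : ∀ x, ∃ m, g^[m] (some x) = none
  · refine absurd ⟨fun x => Nat.find (hall x), fun x y hxy => ?_⟩ h
    have h0 : Nat.find (hall x) ≠ 0 := fun h0 => by
      have := Nat.find_spec (hall x)
      rw [h0] at this
      simp at this
    obtain ⟨m, hm⟩ := Nat.exists_eq_succ_of_ne_zero h0
    have := Nat.find_spec (hall x)
    rw [hm, Nat.succ_eq_add_one, hg, hxy] at this
    change Nat.find (hall y) < Nat.find (hall x)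
    rw [hm]
    exact Nat.lt_succ_of_le (Nat.find_min' _ this)
  · push Not at hall
    obtain ⟨x₀, hx₀⟩ := hall
    rw [← Matrix.exists_mulVec_eq_zero_iff]
    refine ⟨fun x => if ∀ m, g^[m] (some x) ≠ none then 1 else 0, fun h0 => ?_, ?_⟩
    · have := congrFun h0 x₀
      simp [hx₀] at this
    · funext x
      have hrow : (parentMatrix q).mulVec
          (fun x => if ∀ m, g^[m] (some x) ≠ none then 1 else 0) x =
          (if ∀ m, g^[m] (some x) ≠ none then 1 else 0) -
          (if ∀ m, g^[m] (q x) ≠ none then 1 else 0) := by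
        simp only [Matrix.mulVec, dotProduct, parentMatrix, Matrix.of_apply, parentRow_apply,
          sub_mul, ite_mul, one_mul, zero_mul, Finset.sum_sub_distrib, Finset.sum_ite_eq',
          Finset.mem_univ, if_true]
        congr 1
        cases hq : q x with
        | none => simp [hnone]
        | some y => simp [Finset.sum_ite_eq]
      have hiff : (∀ m, g^[m] (some x) ≠ none) ↔ ∀ m, g^[m] (q x) ≠ none := by
        refine ⟨fun hm m => hg m x ▸ hm (m + 1), fun hm m => ?_⟩
        cases m with
        | zero => simp
        | succ m => rw [hg]; exact hm m
      rw [hrow]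
      simp only [hiff, sub_self, Pi.zero_apply]

open Classical in
/-- A matrix-forest theorem: the ranked parent functions with prescribed options are counted by a
determinant. -/
lemma card_ranked_eq_det (S : X → Finset (Option X)) :
    (((Fintype.piFinset S).filter fun q => ∃ r, RankedBy q r).card : ℝ) =
      (Matrix.of fun x => ∑ o ∈ S x, parentRow x o).det := by
  have hlin := (Matrix.detRowAlternating (R := ℝ) (n := X)).toMultilinearMap.map_sum_finset
    (fun x o => parentRow x o) S
  have hlin' : (Matrix.of fun x => ∑ o ∈ S x, parentRow x o).det =
      ∑ q ∈ Fintype.piFinset S, (parentMatrix q).det := hlin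
  rw [hlin', Finset.card_filter, Nat.cast_sum]
  refine Finset.sum_congr rfl fun q _ => ?_
  split_ifs with h
  · obtain ⟨r, hr⟩ := h
    rw [hr.det_parentMatrix, Nat.cast_one]
  · rw [det_parentMatrix_eq_zero h, Nat.cast_zero]

end ForestMatrix

section TreeCount

variable {k u : ℕ}

/-- The admissible parents of a slot in a tree whose root is the slot `top i₀`. -/
def treeOptions (u : ℕ) (i₀ : Fin k) : Slot k u → Finset (Option (Slot k u))
  | .inl (.inl i) => {some (Slot.top i)}
  | .inl (.inr i) => if i = i₀ then {none} else Finset.univ.map Function.Embedding.some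
  | .inr _ => (Finset.univ.disjSum ∅).map Function.Embedding.some

lemma det_diagonal_sub_rankOne (i₀ : Fin k) {c : ℝ} (hc : c ≠ 0) :
    (Matrix.of fun i j : Fin k => (if i = j then (if i = i₀ then 1 else c) else 0) -
      (c / k) * (if i = i₀ then 0 else 1)).det = c ^ (k - 1) / k := by
  have hk : (k : ℝ) ≠ 0 := by
    have := i₀.pos
    positivity
  have hfac : (Matrix.of fun i j : Fin k => (if i = j then (if i = i₀ then 1 else c) else 0) -
      (c / k) * (if i = i₀ then 0 else 1)) =
      Matrix.diagonal (fun i => if i = i₀ then 1 else c) *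
        (1 + Matrix.replicateCol Unit (fun i => if i = i₀ then 0 else -(1 / k : ℝ)) *
          Matrix.replicateRow Unit (fun _ => (1 : ℝ))) := by
    ext i j
    rw [Matrix.diagonal_mul, Matrix.add_apply, Matrix.mul_apply]
    by_cases hi : i = i₀ <;> by_cases hij : i = j <;> simp [Matrix.one_apply, hi, hij] <;> grind
  rw [hfac, Matrix.det_mul, Matrix.det_diagonal, Matrix.det_one_add_replicateCol_mul_replicateRow]
  have hprod : ∏ i : Fin k, (if i = i₀ then 1 else c) = c ^ (k - 1) := by
    rw [Finset.prod_ite]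
    simp [Finset.filter_ne']
  have hdot : (fun _ : Fin k => (1 : ℝ)) ⬝ᵥ (fun i => if i = i₀ then 0 else -(1 / k : ℝ)) =
      -((k : ℝ) - 1) / k := by
    simp only [dotProduct, one_mul]
    rw [Finset.sum_ite]
    have := i₀.pos
    simp [Finset.filter_ne', Nat.cast_sub (Nat.succ_le_of_lt this)]
    ring
  rw [hprod, hdot]
  field_simp
  ring

lemma det_treeOptions (i₀ : Fin k) :
    (Matrix.of fun x => ∑ o ∈ treeOptions u i₀ x, parentRow x o).det * k =
      (2 * k : ℝ) ^ u * (2 * k + u : ℝ) ^ (k - 1) := by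
  have hk : (k : ℝ) ≠ 0 := by
    have := i₀.pos
    positivity
  let c : ℝ := 2 * k
  have hc : c ≠ 0 := by positivity
  let D : Matrix (Fin u) (Fin u) ℝ := c • 1
  let : Invertible D := ⟨c⁻¹ • 1, by simp [D, smul_smul, hc], by simp [D, smul_smul, hc]⟩
  let ρ : Fin k → ℝ := fun i => if i = i₀ then 0 else 1
  let δ : Fin k → ℝ := fun i => if i = i₀ then 1 else 2 * k + u
  let A : Matrix (Fin k ⊕ Fin k) (Fin k ⊕ Fin k) ℝ :=
    Matrix.fromBlocks 1 (-1) (Matrix.of fun i _ => -ρ i) (Matrix.of fun i j =>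
      (if i = j then δ i else 0) - ρ i)
  let B : Matrix (Fin k ⊕ Fin k) (Fin u) ℝ := Matrix.of fun x _ => Sum.elim 0 (fun i => -ρ i) x
  let C : Matrix (Fin u) (Fin k ⊕ Fin k) ℝ := Matrix.of fun _ _ => -1
  have hmat : (Matrix.of fun x => ∑ o ∈ treeOptions u i₀ x, parentRow x o) =
      Matrix.fromBlocks A B C D := by
    ext x y
    rw [Matrix.of_apply, Finset.sum_apply]
    simp only [parentRow_apply, Finset.sum_sub_distrib]
    rcases x with (i | i) | i
    · rcases y with (j | j) | j <;>
        simp [treeOptions, A, B, Matrix.one_apply, @eq_comm _ j _]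
    · by_cases hi : i = i₀ <;> rcases y with (j | j) | j <;>
        simp [treeOptions, A, B, ρ, δ, hi, @eq_comm _ j _, two_mul]
    · rcases y with (j | j) | j <;>
        simp [treeOptions, C, D, c, Matrix.one_apply, @eq_comm _ j _, two_mul]
  have hinv : ⅟D = c⁻¹ • 1 := rfl
  have hschur : A - B * ⅟D * C = Matrix.fromBlocks 1 (-1)
      (Matrix.of fun i _ => -(1 + u / c) * ρ i) (Matrix.of fun i j =>
      (if i = j then δ i else 0) - (1 + u / c) * ρ i) := by
    rw [hinv]
    ext x y
    rcases x with i | i <;> rcases y with j | j <;>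
      simp [A, B, C, Matrix.mul_apply] <;> ring
  rw [hmat, Matrix.det_fromBlocks₂₂, hschur, Matrix.det_fromBlocks_one₁₁]
  have hfin : (Matrix.of fun i j => (if i = j then δ i else 0) - (1 + u / c) * ρ i) -
      (Matrix.of fun i _ => -(1 + u / c) * ρ i) * (-1) =
      Matrix.of fun i j : Fin k => (if i = j then (if i = i₀ then 1 else (2 * k + u : ℝ)) else 0) -
      ((2 * k + u : ℝ) / k) * (if i = i₀ then 0 else 1) := by
    ext i j
    simp [ρ, δ, c]
    split_ifs <;> field_simp <;> ring
  rw [hfin, det_diagonal_sub_rankOne i₀ (by positivity)]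
  simp only [D, Matrix.det_smul, Matrix.det_one, Fintype.card_fin, c]
  field_simp

end TreeCount

section LowerBound

open scoped Nat

variable {n k u : ℕ}

lemma RankedBy.transport {V : Type*} {e : Slot k u ≃ V} {q : Slot k u → Option (Slot k u)}
    {r : Slot k u → ℕ} (h : RankedBy q r) : RankedBy (transport e q) (r ∘ e.symm) := by
  intro x y hxy
  obtain ⟨a, rfl⟩ := e.surjective x
  obtain ⟨b, rfl⟩ := e.surjective y
  simpa using h a b ((transport_apply_eq_some e q a b).1 hxy)

lemma apply_bot_of_mem_treeOptions {i₀ : Fin k} {q : Slot k u → Option (Slot k u)}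
    (hq : q ∈ Fintype.piFinset (treeOptions u i₀)) (i : Fin k) :
    q (Slot.bot i) = some (Slot.top i) := by
  simpa [treeOptions] using (Fintype.mem_piFinset.1 hq) (Slot.bot i)

lemma apply_free_of_mem_treeOptions {i₀ : Fin k} {q : Slot k u → Option (Slot k u)}
    (hq : q ∈ Fintype.piFinset (treeOptions u i₀)) (i : Fin u) :
    ∃ c, q (Slot.free i) = some (Sum.inl c) := by
  have := (Fintype.mem_piFinset.1 hq) (Slot.free i)
  simp only [treeOptions, Finset.mem_map] at this
  obtain ⟨a | a, ha, hqa⟩ := this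
  · exact ⟨a, hqa.symm⟩
  · simp at ha

lemma apply_eq_none_iff_of_mem_treeOptions {i₀ : Fin k} {q : Slot k u → Option (Slot k u)}
    (hq : q ∈ Fintype.piFinset (treeOptions u i₀)) (x : Slot k u) :
    q x = none ↔ x = Slot.top i₀ := by
  rcases x with (i | i) | i
  · simp [apply_bot_of_mem_treeOptions hq]
  · have := (Fintype.mem_piFinset.1 hq) (Slot.top i)
    by_cases hi : i = i₀
    · simpa [treeOptions, hi] using this
    · simp only [treeOptions, hi, if_false, Finset.mem_map] at this
      obtain ⟨a, -, ha⟩ := this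
      simp [← ha, hi]
  · obtain ⟨c, hc⟩ := apply_free_of_mem_treeOptions hq i
    simp [hc]

lemma ncard_pairEdges {V : Type*} (e : Slot k u ≃ V) : (pairEdges e).ncard = k := by
  have hinj : Function.Injective fun i => s(e (Slot.bot i), e (Slot.top i)) := by
    intro i j hij
    simpa using hij
  rw [pairEdges, ← Set.image_univ, Set.ncard_image_of_injective _ hinj, Set.ncard_univ,
    Nat.card_fin]

lemma isMaximalMatching_pairEdges {V : Type*} {i₀ : Fin k} {q : Slot k u → Option (Slot k u)}
    (hq : q ∈ Fintype.piFinset (treeOptions u i₀)) {r : Slot k u → ℕ} (hr : RankedBy q r)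
    (e : Slot k u ≃ V) : IsMaximalMatching (parentGraph (transport e q)) (pairEdges e) := by
  have hadj := (hr.transport (e := e)).adj_iff
  refine ⟨⟨?_, ?_⟩, ?_⟩
  · rintro _ ⟨i, rfl⟩
    rw [SimpleGraph.mem_edgeSet, hadj, transport_apply_eq_some]
    exact Or.inl (apply_bot_of_mem_treeOptions hq i)
  · rintro _ ⟨i, rfl⟩ _ ⟨j, rfl⟩ hne v hv hv'
    have hij : i ≠ j := fun h => hne (by rw [h])
    simp only [Sym2.mem_iff] at hv hv'
    rcases hv with rfl | rfl <;> simp [hij] at hv'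
  · rintro M' hM' ⟨hsub, hnot⟩
    obtain ⟨m, hm, hmn⟩ := Set.not_subset.1 hnot
    have hend : ∃ c, e (Sum.inl c) ∈ m := by
      have key : ∀ x y, transport e q x = some y → ∃ c, e (Sum.inl c) = x ∨ e (Sum.inl c) = y := by
        intro x y hxy
        obtain ⟨a, rfl⟩ := e.surjective x
        obtain ⟨b, rfl⟩ := e.surjective y
        rw [transport_apply_eq_some] at hxy
        rcases a with a | i
        · exact ⟨a, Or.inl rfl⟩
        · obtain ⟨c, hc⟩ := apply_free_of_mem_treeOptions hq i
          exact ⟨c, Or.inr (by rw [Option.some.inj (hc.symm.trans hxy)])⟩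
      have hme := hM'.1 hm
      induction m using Sym2.ind with
      | _ x y =>
        rw [SimpleGraph.mem_edgeSet, hadj] at hme
        rcases hme with h | h
        · obtain ⟨c, h' | h'⟩ := key _ _ h
          · exact ⟨c, Sym2.mem_iff.2 (Or.inl h')⟩
          · exact ⟨c, Sym2.mem_iff.2 (Or.inr h')⟩
        · obtain ⟨c, h' | h'⟩ := key _ _ h
          · exact ⟨c, Sym2.mem_iff.2 (Or.inr h')⟩
          · exact ⟨c, Sym2.mem_iff.2 (Or.inl h')⟩
    obtain ⟨c, hc⟩ := hend
    have hpair : ∃ m' ∈ pairEdges e, e (Sum.inl c) ∈ m' := by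
      rcases c with i | i
      · exact ⟨_, ⟨i, rfl⟩, Sym2.mem_mk_left _ _⟩
      · exact ⟨_, ⟨i, rfl⟩, Sym2.mem_mk_right _ _⟩
    obtain ⟨m', hm', hcm'⟩ := hpair
    exact hM'.2 m hm m' (hsub hm') (fun h => hmn (h ▸ hm')) _ hc hcm'

/-- Two labellings which induce the same ranked parent function and matching differ by a
permutation of the matching edges and of the unmatched vertices. -/
lemma exists_slotPerm_of_transport_eq {V : Type*} {e e' : Slot k u ≃ V}
    {q q' : Slot k u → Option (Slot k u)} {r : Slot k u → ℕ} (hr : RankedBy q r)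
    (hbot : ∀ i, q (Slot.bot i) = some (Slot.top i))
    (hbot' : ∀ i, q' (Slot.bot i) = some (Slot.top i))
    (hM : pairEdges e = pairEdges e') (hP : transport e q = transport e' q') :
    ∃ π, e = (slotPerm π).trans e' ∧ q = conjSlot (slotPerm π) q' := by
  have hpair : ∀ i, ∃ j, e (Slot.bot i) = e' (Slot.bot j) ∧ e (Slot.top i) = e' (Slot.top j) := by
    intro i
    have : s(e (Slot.bot i), e (Slot.top i)) ∈ pairEdges e' := hM ▸ ⟨i, rfl⟩
    obtain ⟨j, hj⟩ := this
    rcases Sym2.eq_iff.1 hj with ⟨h1, h2⟩ | ⟨h1, h2⟩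
    · exact ⟨j, h1.symm, h2.symm⟩
    · have h3 := (transport_apply_eq_some e' q' _ _).2 (hbot' j)
      rw [h1, h2, ← hP, transport_apply_eq_some] at h3
      exact absurd (hr _ _ h3) (not_lt.2 (hr _ _ (hbot i)).le)
  choose f hfb hft using hpair
  have hf : Function.Injective f := by
    intro i j hij
    have := (hfb i).trans ((hij ▸ rfl : e' (Slot.bot (f i)) = e' (Slot.bot (f j))).trans
      (hfb j).symm)
    simpa using this
  have hfs : Function.Surjective f := Finite.surjective_of_injective hf
  have hfree : ∀ i, ∃ j, e (Slot.free i) = e' (Slot.free j) := by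
    intro i
    obtain ⟨y, hy⟩ := e'.surjective (e (Slot.free i))
    rcases y with (y | y) | y
    · obtain ⟨j, rfl⟩ := hfs y
      exact absurd ((hfb j).trans hy) (by simp)
    · obtain ⟨j, rfl⟩ := hfs y
      exact absurd ((hft j).trans hy) (by simp)
    · exact ⟨y, hy.symm⟩
  choose g hg using hfree
  have hgi : Function.Injective g := by
    intro i j hij
    have := (hg i).trans ((hij ▸ rfl : e' (Slot.free (g i)) = e' (Slot.free (g j))).trans
      (hg j).symm)
    simpa using this
  let π : Equiv.Perm (Fin k) × Equiv.Perm (Fin u) :=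
    (Equiv.ofBijective f ⟨hf, hfs⟩, Equiv.ofBijective g ⟨hgi, Finite.surjective_of_injective hgi⟩)
  have he : e = (slotPerm π).trans e' := by
    ext x
    rcases x with (i | i) | i
    · exact hfb i
    · exact hft i
    · exact hg i
  refine ⟨π, he, transport_injective e ?_⟩
  rw [hP]
  conv_rhs => rw [he, transport_conjSlot]

theorem le_matchingCount_mul (hk : 0 < k) (hn : 2 * k + u = n) :
    n ! * ((2 * k) ^ u * n ^ (k - 1)) ≤ matchingCount n k * (k ! * u ! * n * k) := by
  classical
  let i₀ : Fin k := ⟨0, hk⟩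
  let T := (Fintype.piFinset (treeOptions u i₀)).filter fun q => ∃ r, RankedBy q r
  have hT : T.card * k = (2 * k) ^ u * n ^ (k - 1) := by
    have h1 := card_ranked_eq_det (treeOptions u i₀)
    have h2 := det_treeOptions (u := u) i₀
    rw [← h1] at h2
    rw [← hn]
    exact_mod_cast h2
  let Ψ : (Slot k u ≃ Fin n) × T → {p : MMSpace n // p.val.2.ncard = k} × Fin n := fun x =>
    (⟨⟨(parentGraph (transport x.1 x.2.1), pairEdges x.1),
      (Finset.mem_filter.1 x.2.2).2.choose_spec.transport.isAcyclic,
      isMaximalMatching_pairEdges (Finset.mem_filter.1 x.2.2).1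
        (Finset.mem_filter.1 x.2.2).2.choose_spec x.1⟩, ncard_pairEdges x.1⟩, x.1 (Slot.top i₀))
  have : Fintype {p : MMSpace n // p.val.2.ncard = k} := Fintype.ofFinite _
  have hfiber : ∀ y, (Finset.univ.filter fun x => Ψ x = y).card ≤ k ! * u ! := by
    intro y
    rcases (Finset.univ.filter fun x => Ψ x = y).eq_empty_or_nonempty with h0 | ⟨⟨e', q'⟩, hx'⟩
    · simp [h0]
    have hsub : ∀ x ∈ Finset.univ.filter fun x => Ψ x = y,
        ∃ π, x.1 = (slotPerm π).trans e' ∧ x.2.1 = conjSlot (slotPerm π) q'.1 := by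
      rintro ⟨e, q⟩ hx
      have hΨ : Ψ (e, q) = Ψ (e', q') := by
        rw [(Finset.mem_filter.1 hx).2, (Finset.mem_filter.1 hx').2]
      have hG : parentGraph (transport e q.1) = parentGraph (transport e' q'.1) :=
        congrArg (fun z => z.1.1.val.1) hΨ
      have hM : pairEdges e = pairEdges e' := congrArg (fun z => z.1.1.val.2) hΨ
      have hroot : e (Slot.top i₀) = e' (Slot.top i₀) := congrArg (fun z => z.2) hΨ
      obtain ⟨hq, r, hr⟩ := Finset.mem_filter.1 q.2
      obtain ⟨hq', r', hr'⟩ := Finset.mem_filter.1 q'.2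
      refine exists_slotPerm_of_transport_eq hr (apply_bot_of_mem_treeOptions hq)
        (apply_bot_of_mem_treeOptions hq') hM ?_
      refine hr.transport.eq_of_parentGraph_eq hr'.transport (v₀ := e (Slot.top i₀)) ?_ ?_ hG
      · intro x
        obtain ⟨a, rfl⟩ := e.surjective x
        rw [transport_apply, Option.map_eq_none_iff, apply_eq_none_iff_of_mem_treeOptions hq,
          e.injective.eq_iff]
      · intro x
        obtain ⟨a, rfl⟩ := e'.surjective x
        rw [transport_apply, Option.map_eq_none_iff, apply_eq_none_iff_of_mem_treeOptions hq',
          hroot, e'.injective.eq_iff]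
    choose! π hπ using hsub
    have := Finset.card_le_card_of_injOn (t := Finset.univ) π (fun _ _ => Finset.mem_univ _)
      (s := Finset.univ.filter fun x => Ψ x = y) (by
        intro x hx x' hx' h
        refine Prod.ext ?_ (Subtype.ext ?_)
        · rw [(hπ x hx).1, (hπ x' hx').1, h]
        · rw [(hπ x hx).2, (hπ x' hx').2, h])
    simpa [Fintype.card_perm] using this
  have hcard := Finset.card_le_mul_card_image (f := Ψ) Finset.univ (k ! * u !) fun y _ => hfiber y
  have himage := Finset.card_le_univ (Finset.univ.image Ψ)
  have hslot : Fintype.card (Slot k u) = n := by simp; omega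
  rw [Finset.card_univ, Fintype.card_prod, Fintype.card_coe,
    Fintype.card_equiv (Fintype.equivFinOfCardEq hslot), hslot] at hcard
  rw [Fintype.card_prod, Fintype.card_fin, ← Nat.card_eq_fintype_card] at himage
  calc n ! * ((2 * k) ^ u * n ^ (k - 1)) = n ! * T.card * k := by rw [← hT, mul_assoc]
    _ ≤ (k ! * u ! * (matchingCount n k * n)) * k :=
      Nat.mul_le_mul_right _ (hcard.trans (Nat.mul_le_mul_left _ himage))
    _ = matchingCount n k * (k ! * u ! * n * k) := by ring

end LowerBound

section Asymptotics

open scoped Nat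

lemma exists_critical_point :
    ∃ S : ℝ, 0.40037 ≤ S ∧ S ≤ 0.4004 ∧ 2 * (S + 1) * (S ^ 2 * Real.exp (2 * S)) = 1 := by
  have hcont : ContinuousOn (fun s : ℝ => 2 * (s + 1) * (s ^ 2 * Real.exp (2 * s)))
      (Set.Icc 0.40037 0.4004) := by fun_prop
  have hlow : Real.exp (2 * 0.40037) ≤ 2.22725 := by
    refine (Real.exp_bound' (by norm_num) (by norm_num) (n := 10) (by norm_num)).trans ?_
    norm_num [Finset.sum_range_succ, Nat.factorial]
  have hhigh : 2.2273 ≤ Real.exp (2 * 0.4004) := by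
    refine le_trans ?_ (Real.sum_le_exp_of_nonneg (by norm_num) 10)
    norm_num [Finset.sum_range_succ, Nat.factorial]
  obtain ⟨S, ⟨h1, h2⟩, hS⟩ := intermediate_value_Icc (by norm_num) hcont
    (show (1 : ℝ) ∈ Set.Icc _ _ from ⟨by nlinarith, by nlinarith⟩)
  exact ⟨S, h1, h2, hS⟩

lemma factorial_le_mul_pow (m : ℕ) (hm : 1 ≤ m) :
    (m ! : ℝ) ≤ Real.exp 1 * m * (m ^ m * Real.exp (-m)) := by
  induction m, hm using Nat.le_induction with
  | base => simp [← Real.exp_add]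
  | succ m hm ih =>
    have hm0 : (0 : ℝ) < m := by exact_mod_cast hm
    have hstep : (m : ℝ) ^ (m + 1) ≤ (m + 1) ^ (m + 1) * Real.exp (-1) := by
      have h := Real.add_one_le_exp (-1 / (m + 1 : ℝ))
      have h' : (m : ℝ) ≤ (m + 1) * Real.exp (-1 / (m + 1 : ℝ)) := by
        have : (m : ℝ) = (m + 1) * (-1 / (m + 1 : ℝ) + 1) := by field_simp; ring
        calc (m : ℝ) = (m + 1) * (-1 / (m + 1 : ℝ) + 1) := this
          _ ≤ _ := by gcongr
      calc (m : ℝ) ^ (m + 1) ≤ ((m + 1) * Real.exp (-1 / (m + 1 : ℝ))) ^ (m + 1) := by gcongr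
        _ = (m + 1) ^ (m + 1) * Real.exp (-1) := by
          rw [mul_pow, ← Real.exp_nat_mul]
          congr 2
          push_cast
          field_simp
    calc ((m + 1)! : ℝ) = (m + 1) * m ! := by rw [Nat.factorial_succ]; push_cast; ring
      _ ≤ (m + 1) * (Real.exp 1 * m * (m ^ m * Real.exp (-m))) := by gcongr
      _ = Real.exp 1 * (m + 1) * (m ^ (m + 1) * Real.exp (-m)) := by ring
      _ ≤ Real.exp 1 * (m + 1) * ((m + 1) ^ (m + 1) * Real.exp (-1) * Real.exp (-m)) := by gcongr
      _ = Real.exp 1 * ((m + 1 : ℕ) : ℝ) *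
          (((m + 1 : ℕ) : ℝ) ^ (m + 1) * Real.exp (-((m + 1 : ℕ) : ℝ))) := by
        rw [mul_assoc ((m + 1 : ℝ) ^ (m + 1)), ← Real.exp_add]
        push_cast
        ring_nf

/-- Near its maximum, the exponential series term `y ^ m / m!` is comparable to `exp y`. -/
lemma exp_le_pow_mul_factorial {y d : ℝ} {m : ℕ} (hm : 1 ≤ m) (hy : 0 < y) (hd : 0 ≤ d)
    (h1 : m ≤ y + d) (h2 : m ≤ 2 * y) :
    Real.exp (m - 1 - 2 * d) * m ! ≤ m * y ^ m := by
  have hm0 : (0 : ℝ) < m := by exact_mod_cast hm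
  have hpow : (m : ℝ) ^ m * Real.exp (-(2 * d)) ≤ y ^ m := by
    have h3 : (m : ℝ) ≤ y * Real.exp (d / y) := by
      have := Real.add_one_le_exp (d / y)
      calc (m : ℝ) ≤ y * (d / y + 1) := by field_simp; linarith
        _ ≤ _ := by gcongr
    calc (m : ℝ) ^ m * Real.exp (-(2 * d)) ≤ (y * Real.exp (d / y)) ^ m * Real.exp (-(2 * d)) := by
          gcongr
      _ = y ^ m * Real.exp (m * (d / y) - 2 * d) := by
          rw [mul_pow, ← Real.exp_nat_mul, mul_assoc, ← Real.exp_add, sub_eq_add_neg]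
      _ ≤ y ^ m * 1 := by
          gcongr
          rw [Real.exp_le_one_iff, sub_nonpos, mul_div_assoc', div_le_iff₀ hy]
          nlinarith
      _ = y ^ m := mul_one _
  calc Real.exp (m - 1 - 2 * d) * m !
      ≤ Real.exp (m - 1 - 2 * d) * (Real.exp 1 * m * (m ^ m * Real.exp (-m))) := by
        gcongr
        exact factorial_le_mul_pow m hm
    _ = m * (m ^ m * (Real.exp (m - 1 - 2 * d) * Real.exp 1 * Real.exp (-m))) := by ring
    _ = m * (m ^ m * Real.exp (-(2 * d))) := by
        rw [← Real.exp_add, ← Real.exp_add]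
        ring_nf
    _ ≤ m * y ^ m := by gcongr

variable {S A : ℝ}

lemma matchingCount_mul_pow_le (hS : 0 < S) (hA : A = S ^ 2 * Real.exp (2 * S)) {t : ℝ}
    (ht : 0 < t) (n k : ℕ) :
    matchingCount n k * S ^ n * t ^ k ≤
      n ! * (Real.exp (S + A * t) * Real.exp (A * t * n)) := by
  rcases lt_or_ge n (2 * k) with hlt | hge
  · have : matchingCount n k = 0 := by
      rw [matchingCount, Nat.card_eq_zero]
      refine Or.inl ⟨fun p => ?_⟩
      have := two_mul_ncard_le p.1
      rw [p.2] at this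
      omega
    rw [this]
    simp only [Nat.cast_zero, zero_mul]
    positivity
  obtain ⟨u, rfl⟩ := Nat.exists_eq_add_of_le hge
  have hA0 : 0 < A := by rw [hA]; positivity
  set n := 2 * k + u with hn
  have h1 : (matchingCount n k : ℝ) * (k ! * u !) ≤ n ! * ((n + 1) ^ k * (2 * k + 1) ^ u) := by
    exact_mod_cast matchingCount_mul_le (n := n) hn.symm
  have h2 := Real.pow_div_factorial_le_exp ((2 * k + 1) * S) (by positivity) u
  have h3 := Real.pow_div_factorial_le_exp (A * t * (n + 1)) (by positivity) k
  have hkey : (n + 1 : ℝ) ^ k * (2 * k + 1) ^ u * S ^ n * t ^ k * Real.exp (2 * S * k) =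
      ((2 * k + 1) * S) ^ u * (A * t * (n + 1)) ^ k := by
    have : Real.exp (2 * S * k) = Real.exp (2 * S) ^ k := by
      rw [← Real.exp_nat_mul]; ring_nf
    rw [this, hA, hn, pow_add S, pow_mul]
    simp only [mul_pow]
    ring
  have hfin : (matchingCount n k * S ^ n * t ^ k) * Real.exp (2 * S * k) ≤
      (n ! * (Real.exp (S + A * t) * Real.exp (A * t * n))) * Real.exp (2 * S * k) := by
    calc (matchingCount n k * S ^ n * t ^ k) * Real.exp (2 * S * k)
        = (matchingCount n k * (k ! * u !)) / (k ! * u !) *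
          (S ^ n * t ^ k * Real.exp (2 * S * k)) := by field_simp
      _ ≤ (n ! * ((n + 1) ^ k * (2 * k + 1) ^ u)) / (k ! * u !) *
          (S ^ n * t ^ k * Real.exp (2 * S * k)) := by gcongr
      _ = n ! * ((n + 1 : ℝ) ^ k * (2 * k + 1) ^ u * S ^ n * t ^ k * Real.exp (2 * S * k)) /
          (k ! * u !) := by ring
      _ = n ! * ((((2 * k + 1) * S) ^ u / u !) * ((A * t * (n + 1)) ^ k / k !)) := by
          rw [hkey]; field_simp
      _ ≤ n ! * (Real.exp ((2 * k + 1) * S) * Real.exp (A * t * (n + 1))) := by gcongr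
      _ = _ := by
          rw [mul_assoc (n ! : ℝ), ← Real.exp_add, ← Real.exp_add, ← Real.exp_add]
          ring_nf
  exact le_of_mul_le_mul_right hfin (Real.exp_pos _)

lemma matchingCount_tail_le (hS : 0 < S) (hA : A = S ^ 2 * Real.exp (2 * S)) (hA1 : A < 1) {ε : ℝ}
    (hε : 0 < ε) (hεA : ε < A) :
    ∃ C c : ℝ, 0 < C ∧ 0 < c ∧ ∀ n k : ℕ, ε * n ≤ |k - A * n| →
      matchingCount n k * S ^ n ≤ n ! * (C * Real.exp ((A - c) * n)) := by
  have hA0 : 0 < A := hε.trans hεA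
  have chernoff : ∀ t c : ℝ, 0 < t → ∀ n k : ℕ, A * (t - 1) * n - k * Real.log t ≤ -c * n →
      matchingCount n k * S ^ n ≤ n ! * (Real.exp (S + A * t) * Real.exp ((A - c) * n)) := by
    intro t c ht n k h
    have hpow : t ^ k = Real.exp (k * Real.log t) := by
      rw [Real.exp_nat_mul, Real.exp_log ht]
    have h1 := matchingCount_mul_pow_le hS hA ht n k
    refine le_of_mul_le_mul_right (h1.trans ?_) (pow_pos ht k)
    rw [hpow]
    calc n ! * (Real.exp (S + A * t) * Real.exp (A * t * n))
        ≤ n ! * (Real.exp (S + A * t) * Real.exp ((A - c) * n + k * Real.log t)) := by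
          gcongr
          linarith
      _ = _ := by
          rw [Real.exp_add _ (k * Real.log t)]
          ring
  set δ : ℝ := ε / 2 with hδ
  have hδ0 : 0 < δ := by positivity
  have hδ1 : δ < 1 := by rw [hδ]; linarith
  have hAδ : A * δ < ε := by rw [hδ]; nlinarith
  set c₁ : ℝ := δ / (1 + δ) * (ε - A * δ) with hc₁
  set c₂ : ℝ := δ / (1 - δ) * (ε - A * δ) with hc₂
  have h1δ : 0 < 1 - δ := by linarith
  have hc₁0 : 0 < c₁ := mul_pos (by positivity) (by linarith)
  have hc₂0 : 0 < c₂ := mul_pos (by positivity) (by linarith)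
  refine ⟨Real.exp (S + A * (1 + δ)), min c₁ c₂, Real.exp_pos _, lt_min hc₁0 hc₂0, ?_⟩
  intro n k hk
  have hn : (0 : ℝ) ≤ n := n.cast_nonneg
  rcases le_abs.1 hk with h | h
  · have hlog := Real.one_sub_inv_le_log_of_pos (show 0 < 1 + δ by linarith)
    have hlog' : δ / (1 + δ) ≤ Real.log (1 + δ) := by
      convert hlog using 1
      field_simp
      ring
    refine (chernoff (1 + δ) c₁ (by linarith) n k ?_).trans ?_
    · have h2 : (A + ε) * n * (δ / (1 + δ)) ≤ k * Real.log (1 + δ) :=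
        mul_le_mul (by linarith) hlog' (by positivity) (by positivity)
      have h3 : A * (1 + δ - 1) * n - (A + ε) * n * (δ / (1 + δ)) = -c₁ * n := by
        rw [hc₁]; field_simp; ring
      linarith
    · gcongr
      exact min_le_left _ _
  · have hlog := Real.one_sub_inv_le_log_of_pos h1δ
    have hlog' : -Real.log (1 - δ) ≤ δ / (1 - δ) := by
      have : δ / (1 - δ) = -(1 - (1 - δ)⁻¹) := by field_simp; ring
      rw [this]
      exact neg_le_neg hlog
    have hneg : 0 ≤ -Real.log (1 - δ) := by
      have := Real.log_nonpos h1δ.le (by linarith)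
      linarith
    refine (chernoff (1 - δ) c₂ h1δ n k ?_).trans ?_
    · have h2 : k * -Real.log (1 - δ) ≤ (A - ε) * n * (δ / (1 - δ)) :=
        mul_le_mul (by linarith) hlog' hneg (mul_nonneg (by linarith) hn)
      have h3 : A * (1 - δ - 1) * n + (A - ε) * n * (δ / (1 - δ)) = -c₂ * n := by
        rw [hc₂]; field_simp; ring
      linarith
    · gcongr
      · linarith
      · exact min_le_right _ _

lemma eventually_le_mN (hS : 0 < S) (hS1 : S < 1 / 2) (hA : A = S ^ 2 * Real.exp (2 * S))
    (hSA : A * (2 * S + 2) = 1) :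
    ∀ᶠ n : ℕ in atTop, (n ! : ℝ) * Real.exp (A * n) ≤ mN n * S ^ n * (n ^ 5 * Real.exp 9) := by
  have hA0 : 0 < A := by rw [hA]; positivity
  have hlarge : ∀ᶠ n : ℕ in atTop, 3 ≤ 2 * S * (A * n - 1) ∧ 1 ≤ A * n := by
    have h1 : Tendsto (fun n : ℕ => A * (n : ℝ)) atTop atTop :=
      tendsto_natCast_atTop_atTop.const_mul_atTop hA0
    filter_upwards [h1.eventually_ge_atTop (3 / (2 * S) + 1), h1.eventually_ge_atTop 1]
      with n hn hn'
    refine ⟨?_, hn'⟩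
    have : 3 / (2 * S) ≤ A * n - 1 := by linarith
    rwa [div_le_iff₀' (by positivity)] at this
  filter_upwards [hlarge] with n ⟨hn3, hn1⟩
  set k : ℕ := ⌊A * n⌋₊ with hk
  have hkle : (k : ℝ) ≤ A * n := Nat.floor_le (by positivity)
  have hklt : A * n < k + 1 := Nat.lt_floor_add_one _
  have hk1 : 1 ≤ k := Nat.le_floor (by simpa using hn1)
  have hn0 : (0 : ℝ) ≤ n := n.cast_nonneg
  have hAn : 2 * S * (A * n) = n - 2 * (A * n) := by linear_combination (n : ℝ) * hSA
  have h2k : 2 * k ≤ n := by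
    have h : (2 * k : ℝ) ≤ n := by nlinarith [mul_pos hS hA0]
    exact_mod_cast h
  obtain ⟨u, hu⟩ := Nat.exists_eq_add_of_le h2k
  have huR : (n : ℝ) = 2 * k + u := by exact_mod_cast hu
  have hk0 : (0 : ℝ) < k := by exact_mod_cast hk1
  have hy : 2 * S * (A * n - 1) ≤ 2 * S * k := by gcongr; linarith
  have huy : 2 * S * k ≤ u := by nlinarith
  have huy' : (u : ℝ) ≤ 2 * S * k + 3 := by nlinarith
  have hu1 : 1 ≤ u := by
    have : (1 : ℝ) ≤ u := by linarith
    exact_mod_cast this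
  have hE1 := exp_le_pow_mul_factorial (y := 2 * S * k) (d := 3) hu1 (by positivity) (by norm_num)
    huy' (by linarith)
  have hE2 := exp_le_pow_mul_factorial (y := A * n) (d := 0) hk1 (by linarith) le_rfl
    (by linarith) (by linarith)
  have hlow : (n ! : ℝ) * ((2 * k) ^ u * n ^ (k - 1)) ≤
      matchingCount n k * (k ! * u ! * n * k) := by
    exact_mod_cast le_matchingCount_mul hk1 hu.symm
  have hcount : (matchingCount n k : ℝ) ≤ mN n := by
    exact_mod_cast Finite.card_subtype_le _
  have hkn : (k : ℝ) ≤ n := by exact_mod_cast (by omega : k ≤ n)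
  have hun : (u : ℝ) ≤ n := by exact_mod_cast (by omega : u ≤ n)
  have hnpow : (n : ℝ) ^ k = n ^ (k - 1) * n := by
    rw [← pow_succ, Nat.sub_add_cancel hk1]
  have hkey : (2 * S * k) ^ u * (A * n) ^ k =
      S ^ n * ((2 * k) ^ u * n ^ (k - 1)) * n * Real.exp (2 * S * k) := by
    have : Real.exp (2 * S * k) = Real.exp (2 * S) ^ k := by
      rw [← Real.exp_nat_mul]; ring_nf
    rw [this, mul_pow A, hnpow, hA, hu, pow_add S, pow_mul]
    simp only [mul_pow]
    ring
  have hprod : Real.exp (u - 1 - 2 * 3) * u ! * (Real.exp (k - 1 - 2 * 0) * k !) ≤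
      u * (2 * S * k) ^ u * (k * (A * n) ^ k) := by gcongr
  have hexp : Real.exp (A * n) * Real.exp (2 * S * k) ≤
      Real.exp (u - 1 - 2 * 3) * Real.exp (k - 1 - 2 * 0) * Real.exp 9 := by
    rw [← Real.exp_add, ← Real.exp_add, ← Real.exp_add]
    exact Real.exp_le_exp.2 (by linarith)
  have hfin : (n ! * Real.exp (A * n)) * (Real.exp (2 * S * k) * (k ! * u !)) ≤
      (mN n * S ^ n * (n ^ 5 * Real.exp 9)) * (Real.exp (2 * S * k) * (k ! * u !)) := by
    calc (n ! * Real.exp (A * n)) * (Real.exp (2 * S * k) * (k ! * u !))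
        = n ! * (k ! * u !) * (Real.exp (A * n) * Real.exp (2 * S * k)) := by ring
      _ ≤ n ! * (k ! * u !) *
          (Real.exp (u - 1 - 2 * 3) * Real.exp (k - 1 - 2 * 0) * Real.exp 9) := by gcongr
      _ = n ! * (Real.exp (u - 1 - 2 * 3) * u ! * (Real.exp (k - 1 - 2 * 0) * k !)) *
          Real.exp 9 := by ring
      _ ≤ n ! * (u * (2 * S * k) ^ u * (k * (A * n) ^ k)) * Real.exp 9 := by gcongr
      _ = n ! * ((2 * S * k) ^ u * (A * n) ^ k) * (u * k) * Real.exp 9 := by ring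
      _ = (n ! * ((2 * k) ^ u * n ^ (k - 1))) * (S ^ n * n * Real.exp (2 * S * k) * (u * k) *
          Real.exp 9) := by rw [hkey]; ring
      _ ≤ (matchingCount n k * (k ! * u ! * n * k)) * (S ^ n * n * Real.exp (2 * S * k) * (u * k) *
          Real.exp 9) := by gcongr
      _ ≤ (mN n * (k ! * u ! * n * n)) * (S ^ n * n * Real.exp (2 * S * k) * (n * n) *
          Real.exp 9) := by gcongr
      _ = _ := by ring
  exact le_of_mul_le_mul_right hfin (by positivity)

lemma tendsto_pow_mul_exp_neg {c : ℝ} (hc : 0 < c) (C : ℝ) :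
    Tendsto (fun n : ℕ => C * (((n : ℝ) + 1) * n ^ 5 * Real.exp (-c * n))) atTop (𝓝 0) := by
  have hcn : Tendsto (fun n : ℕ => c * (n : ℝ)) atTop atTop :=
    tendsto_natCast_atTop_atTop.const_mul_atTop hc
  have h : ∀ m : ℕ, Tendsto (fun n : ℕ => (n : ℝ) ^ m * Real.exp (-c * n)) atTop (𝓝 0) := by
    intro m
    have := ((Real.tendsto_pow_mul_exp_neg_atTop_nhds_zero m).comp hcn).const_mul ((c ^ m)⁻¹)
    rw [mul_zero] at this
    refine this.congr fun n => ?_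
    rw [Function.comp_apply, mul_pow, neg_mul]
    field_simp
  have := ((h 6).add (h 5)).const_mul C
  simp only [add_zero, mul_zero] at this
  refine this.congr fun n => ?_
  ring

/-- The mean of `|M|` is close to `A * n` up to the proportion of exceptional pairs. -/
lemma abs_Ebar_div_sub_le {ε : ℝ} (hε : 0 ≤ ε) (hA0 : 0 ≤ A) (hA1 : A ≤ 1) {n : ℕ} (hn : 0 < n)
    (hm : 0 < mN n) :
    |Ebar n / n - A| ≤ ε +
      Nat.card {p : MMSpace n // ε * n ≤ |p.val.2.ncard - A * n|} / mN n := by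
  classical
  have := Fintype.ofFinite (MMSpace n)
  have hn0 : (0 : ℝ) < n := by exact_mod_cast hn
  have hm0 : (0 : ℝ) < mN n := by exact_mod_cast hm
  have hcard : (mN n : ℝ) = ∑ _p : MMSpace n, (1 : ℝ) := by
    simp [mN, Nat.card_eq_fintype_card]
  have hE : Ebar n / n - A = (∑ p : MMSpace n, ((p.val.2.ncard : ℝ) - A * n)) / (n * mN n) := by
    have hsum : ∑ p : MMSpace n, ((p.val.2.ncard : ℝ) - A * n) =
        (∑ p : MMSpace n, (p.val.2.ncard : ℝ)) - mN n * (A * n) := by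
      rw [Finset.sum_sub_distrib, hcard, Finset.sum_mul]
      simp only [one_mul]
    rw [hsum, Ebar, finsum_eq_sum_of_fintype]
    field_simp
  have hbad : (Nat.card {p : MMSpace n // ε * n ≤ |p.val.2.ncard - A * n|} : ℝ) =
      ∑ p : MMSpace n, if ε * n ≤ |p.val.2.ncard - A * n| then (1 : ℝ) else 0 := by
    rw [Nat.card_eq_fintype_card, Fintype.card_subtype, Finset.sum_boole]
  have hterm : ∀ p : MMSpace n, |(p.val.2.ncard : ℝ) - A * n| ≤
      n * (ε * 1 + if ε * n ≤ |p.val.2.ncard - A * n| then (1 : ℝ) else 0) := by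
    intro p
    split_ifs with h
    · have h2 : (p.val.2.ncard : ℝ) ≤ n := by
        exact_mod_cast (by have := two_mul_ncard_le p; omega : p.val.2.ncard ≤ n)
      have h0 : (0 : ℝ) ≤ p.val.2.ncard := Nat.cast_nonneg _
      rw [abs_le]
      constructor <;> nlinarith
    · linarith
  rw [hE, abs_div, abs_of_pos (mul_pos hn0 hm0), div_le_iff₀ (mul_pos hn0 hm0)]
  refine (Finset.abs_sum_le_sum_abs _ _).trans ((Finset.sum_le_sum fun p _ => hterm p).trans ?_)
  rw [← Finset.mul_sum, Finset.sum_add_distrib, ← Finset.mul_sum, ← hcard, ← hbad]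
  field_simp
  exact le_rfl

lemma card_tail_le (P : ℕ → Prop) {n : ℕ} {b : ℝ}
    (h : ∀ k, P k → (matchingCount n k : ℝ) ≤ b) (hb : 0 ≤ b) :
    (Nat.card {p : MMSpace n // P p.val.2.ncard} : ℝ) ≤ (n + 1) * b := by
  classical
  have := Fintype.ofFinite (MMSpace n)
  rw [Nat.card_eq_fintype_card, Fintype.card_subtype]
  have hmaps : ∀ p ∈ Finset.univ.filter (fun p : MMSpace n => P p.val.2.ncard),
      p.val.2.ncard ∈ Finset.range (n + 1) := fun p _ =>
    Finset.mem_range.2 (by have := two_mul_ncard_le p; omega)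
  rw [Finset.card_eq_sum_card_fiberwise hmaps]
  push_cast
  calc _ ≤ ∑ _k ∈ Finset.range (n + 1), b := Finset.sum_le_sum fun k _ => ?_
    _ = (n + 1) * b := by simp
  by_cases hk : P k
  · refine le_trans ?_ (h k hk)
    rw [matchingCount, Nat.card_eq_fintype_card, Fintype.card_subtype]
    gcongr
    exact Finset.subset_univ _
  · rw [Finset.card_eq_zero.2, Nat.cast_zero]
    · exact hb
    · refine Finset.filter_eq_empty_iff.2 fun p hp hpk => hk ?_
      exact hpk ▸ (Finset.mem_filter.1 hp).2

/-- Concentration of `|M|` around `A * n` forces the means to converge. -/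
theorem tendsto_Ebar_div (hS : 0 < S) (hS1 : S < 1 / 2) (hA : A = S ^ 2 * Real.exp (2 * S))
    (hSA : A * (2 * S + 2) = 1) : Tendsto (fun n : ℕ => Ebar n / (n : ℝ)) atTop (𝓝 A) := by
  have hA0 : 0 < A := by rw [hA]; positivity
  have hA1 : A < 1 := by nlinarith
  rw [Metric.tendsto_atTop']
  simp only [Real.dist_eq]
  suffices h : ∀ η : ℝ, 0 < η → ∀ᶠ n : ℕ in atTop, |Ebar n / n - A| < η by
    intro η hη
    obtain ⟨N, hN⟩ := eventually_atTop.1 (h η hη)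
    exact ⟨N, fun n hn => hN n hn.le⟩
  intro η hη
  set ε : ℝ := min (η / 2) (A / 2) with hε
  have hε0 : 0 < ε := lt_min (by linarith) (by linarith)
  have hεη : ε ≤ η / 2 := min_le_left _ _
  have hεA : ε < A := (min_le_right _ _).trans_lt (by linarith)
  obtain ⟨C, c, hC, hc, htail⟩ := matchingCount_tail_le hS hA hA1 hε0 hεA
  have hlim := (tendsto_pow_mul_exp_neg hc (C * Real.exp 9)).eventually_lt_const (half_pos hη)
  filter_upwards [hlim, eventually_le_mN hS hS1 hA hSA, eventually_gt_atTop 0]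
    with n hn hlow hn0
  have hSn : 0 < S ^ n := pow_pos hS n
  have hm : 0 < mN n := by
    rcases Nat.eq_zero_or_pos (mN n) with h | h
    · have : 0 < (n ! : ℝ) * Real.exp (A * n) := by positivity
      rw [h] at hlow
      simp only [Nat.cast_zero, zero_mul] at hlow
      linarith
    · exact h
  have hm0 : (0 : ℝ) < mN n := by exact_mod_cast hm
  have hbad : (Nat.card {p : MMSpace n // ε * n ≤ |(p.val.2.ncard : ℝ) - A * n|} : ℝ) ≤
      (n + 1) * (n ! * (C * Real.exp ((A - c) * n)) / S ^ n) :=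
    card_tail_le (fun k => ε * n ≤ |(k : ℝ) - A * n|)
      (fun k hk => (le_div_iff₀ hSn).2 (htail n k hk)) (by positivity)
  have hratio : (Nat.card {p : MMSpace n // ε * n ≤ |(p.val.2.ncard : ℝ) - A * n|} : ℝ) / mN n ≤
      C * Real.exp 9 * (((n : ℝ) + 1) * n ^ 5 * Real.exp (-c * n)) := by
    rw [div_le_iff₀ hm0]
    refine hbad.trans ?_
    rw [mul_div_assoc', div_le_iff₀ hSn]
    calc (n + 1) * (n ! * (C * Real.exp ((A - c) * n)))
        = (n ! * Real.exp (A * n)) * ((n + 1) * C * Real.exp (-c * n)) := by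
          rw [sub_mul, sub_eq_add_neg, Real.exp_add, neg_mul]
          ring
      _ ≤ (mN n * S ^ n * (n ^ 5 * Real.exp 9)) * ((n + 1) * C * Real.exp (-c * n)) := by gcongr
      _ = _ := by ring
  have := abs_Ebar_div_sub_le (A := A) hε0.le hA0.le hA1.le hn0 hm
  linarith

end Asymptotics

theorem stmt_16 :
    ∃ lam : ℝ, 0.35704 < lam ∧ lam < 0.35705 ∧
      Tendsto (fun n : ℕ => Ebar n / (n : ℝ)) atTop (nhds lam) := by
  obtain ⟨S, h1, h2, hS⟩ := exists_critical_point
  have hS0 : 0 < S := by linarith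
  have hSA : S ^ 2 * Real.exp (2 * S) * (2 * S + 2) = 1 := by linear_combination hS
  refine ⟨S ^ 2 * Real.exp (2 * S), ?_, ?_, tendsto_Ebar_div hS0 (by linarith) rfl hSA⟩ <;>
    nlinarith [mul_pos (pow_pos hS0 2) (Real.exp_pos (2 * S))]
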